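/- Let C ⊆ (Fin 8 → ZMod 8) be the octacode, i.e. the Z8-submodule generated by the four rows (5,7,5,6,1,0,0,0), (5,0,7,5,6,1,0,0), (5,0,0,7,5,6,1,0), (5,0,0,0,7,5,6,1). Then r_HW(C) ≥ 6. -/

import Mathlib

open Finset

/-- Homogeneous weight on `ZMod 8`. -/
def wHW (x : ZMod 8) : ℕ := if x = 0 then 0 else if x = 4 then 4 else 2

/-- Lee weight on `ZMod 8`. -/
def wL (x : ZMod 8) : ℕ := min x.val (8 - x.val)

/-- Euclidean weight on `ZMod 8`. -/
def wE (x : ZMod 8) : ℕ := min (x.val ^ 2) ((8 - x.val) ^ 2)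

/-- The distance on `Fin n → ZMod 8` induced by a weight `w` on `ZMod 8`. -/
def distOf (w : ZMod 8 → ℕ) {n : ℕ} (x y : Fin n → ZMod 8) : ℕ := ∑ i, w (x i - y i)

/-- The covering radius of a code `C ⊆ α` with respect to a distance `d`:
the maximum over all `u` of the minimum distance from `u` to the code. -/
noncomputable def covRadius {α : Type*} [Fintype α] (d : α → α → ℕ) (C : Set α) : ℕ :=
  ⨆ u : α, sInf {r | ∃ c ∈ C, r = d u c}

/-- The octacode over `ZMod 8`: the span of the four given rows. -/
def octacode : Submodule (ZMod 8) (Fin 8 → ZMod 8) :=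
  Submodule.span (ZMod 8)
    {![5,7,5,6,1,0,0,0], ![5,0,7,5,6,1,0,0], ![5,0,0,7,5,6,1,0], ![5,0,0,0,7,5,6,1]}

theorem le_covRadius {α : Type*} [Fintype α] {d : α → α → ℕ} {C : Set α} {r : ℕ}
    (hC : C.Nonempty) (u : α) (h : ∀ c ∈ C, r ≤ d u c) : r ≤ covRadius d C := by
  refine le_trans ?_ (le_ciSup (Set.finite_range _).bddAbove u)
  obtain ⟨c, hc⟩ := hC
  refine le_csInf ⟨_, c, hc, rfl⟩ ?_
  rintro _ ⟨c, hc, rfl⟩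
  exact h c hc

theorem mem_octacode {x : Fin 8 → ZMod 8} (hx : x ∈ octacode) :
    ∃ a b c d : ZMod 8, x = ![5 * (a + b + c + d), 7 * a, 5 * a + 7 * b, 6 * a + 5 * b + 7 * c,
      a + 6 * b + 5 * c + 7 * d, b + 6 * c + 5 * d, c + 6 * d, d] := by
  simp only [octacode, Submodule.mem_span_insert, Submodule.mem_span_singleton] at hx
  obtain ⟨a, _, ⟨b, _, ⟨c, _, ⟨d, rfl⟩, rfl⟩, rfl⟩, rfl⟩ := hx
  refine ⟨a, b, c, d, ?_⟩
  ext i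
  fin_cases i <;> simp <;> ring

/-- Reduction of `ZMod 8` modulo `2`. -/
def reduceTwo : ZMod 8 →+* ZMod 2 := ZMod.castHom (by decide : 2 ∣ 8) (ZMod 2)

theorem two_mul_val_reduceTwo_le_wHW (x : ZMod 8) : 2 * (reduceTwo x).val ≤ wHW x := by
  revert x
  decide

theorem reduceTwo_eq_zero {x : ZMod 8} (hx : reduceTwo x = 0) :
    ∃ k : Fin 4, x = ![0, 2, 4, 6] k := by
  revert x
  decide

/-- Modulo `2`, the vector `(0, 0, 1, 4, 0, 0, 0, 0)` is a unit vector, at Hamming distance at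
least `3` from every nonzero word of the reduced code. -/
theorem three_le_sum_val (a b c d : ZMod 2) (h : ¬(a = 0 ∧ b = 0 ∧ c = 0 ∧ d = 0)) :
    3 ≤ (a + b + c + d).val + a.val + (1 - (a + b)).val + (b + c).val + (a + c + d).val +
      (b + d).val + c.val + d.val := by
  revert a b c d
  decide

theorem six_le_sum_wHW_of_even (i j k l : Fin 4) :
    letI e : Fin 4 → ZMod 8 := ![0, 2, 4, 6]
    6 ≤ wHW (5 * (e i + e j + e k + e l)) + wHW (7 * e i) + wHW (1 - (5 * e i + 7 * e j)) +
      wHW (4 - (6 * e i + 5 * e j + 7 * e k)) + wHW (e i + 6 * e j + 5 * e k + 7 * e l) +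
      wHW (e j + 6 * e k + 5 * e l) + wHW (e k + 6 * e l) + wHW (e l) := by
  revert i j k l
  decide +kernel

theorem six_le_sum_wHW (a b c d : ZMod 8) :
    6 ≤ wHW (5 * (a + b + c + d)) + wHW (7 * a) + wHW (1 - (5 * a + 7 * b)) +
      wHW (4 - (6 * a + 5 * b + 7 * c)) + wHW (a + 6 * b + 5 * c + 7 * d) +
      wHW (b + 6 * c + 5 * d) + wHW (c + 6 * d) + wHW d := by
  by_cases h : reduceTwo a = 0 ∧ reduceTwo b = 0 ∧ reduceTwo c = 0 ∧ reduceTwo d = 0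
  · obtain ⟨ha, hb, hc, hd⟩ := h
    obtain ⟨i, rfl⟩ := reduceTwo_eq_zero ha
    obtain ⟨j, rfl⟩ := reduceTwo_eq_zero hb
    obtain ⟨k, rfl⟩ := reduceTwo_eq_zero hc
    obtain ⟨l, rfl⟩ := reduceTwo_eq_zero hd
    exact six_le_sum_wHW_of_even i j k l
  · have key := three_le_sum_val _ _ _ _ h
    have h1 := two_mul_val_reduceTwo_le_wHW (5 * (a + b + c + d))
    have h2 := two_mul_val_reduceTwo_le_wHW (7 * a)
    have h3 := two_mul_val_reduceTwo_le_wHW (1 - (5 * a + 7 * b))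
    have h4 := two_mul_val_reduceTwo_le_wHW (4 - (6 * a + 5 * b + 7 * c))
    have h5 := two_mul_val_reduceTwo_le_wHW (a + 6 * b + 5 * c + 7 * d)
    have h6 := two_mul_val_reduceTwo_le_wHW (b + 6 * c + 5 * d)
    have h7 := two_mul_val_reduceTwo_le_wHW (c + 6 * d)
    have h8 := two_mul_val_reduceTwo_le_wHW d
    have e4 : reduceTwo 4 = 0 := by decide
    have e5 : reduceTwo 5 = 1 := by decide
    have e6 : reduceTwo 6 = 0 := by decide
    have e7 : reduceTwo 7 = 1 := by decide
    simp only [map_add, map_sub, map_mul, map_one, e4, e5, e6, e7, one_mul, zero_mul, add_zero,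
      zero_add, zero_sub, ZMod.neg_eq_self_mod_two] at h1 h2 h3 h4 h5 h6 h7 h8
    omega

theorem wHW_neg (x : ZMod 8) : wHW (-x) = wHW x := by
  revert x
  decide

theorem covRadius_octacode :
    6 ≤ covRadius (distOf wHW) (octacode : Set (Fin 8 → ZMod 8)) := by
  refine le_covRadius ⟨0, octacode.zero_mem⟩ ![0, 0, 1, 4, 0, 0, 0, 0] fun x hx => ?_
  obtain ⟨a, b, c, d, rfl⟩ := mem_octacode hx
  refine (six_le_sum_wHW a b c d).trans_eq ?_
  simp only [distOf, Fin.sum_univ_eight]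
  simp [-neg_add_rev, wHW_neg]
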